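/- Under the AWGN model with noise parameter σ² satisfying 0 < σ² < u_min²/2, the maximum likelihood estimator achieves vanishing normalized square error in the sublinear sparsity limit. Precisely: let γ ∈ [0,1), let (k_n) and (N_n) be sequences of naturals with k_n → ∞, k_n < N_n, and (log k_n)/(log N_n) → γ. For each n, let x be uniformly distributed on X_{k_n}^{N_n}(U), let ω ∈ ℝ^{N_n} have i.i.d. N(0, σ²/log(N_n/k_n)) entries independent of x, and set y = x + ω. Let x̂_n : ℝ^{N_n} → X_{k_n}^{N_n}(U) be any measurable function satisfying ‖y − x̂_n(y)‖₂ ≤ ‖y − x'‖₂ for every y ∈ ℝ^{N_n} and every x' ∈ X_{k_n}^{N_n}(U) (a maximum likelihood selector). Then (1/k_n)·E[‖x − x̂_n(y)‖₂²] → 0 as n → ∞. -/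

import Mathlib

open MeasureTheory ProbabilityTheory Real Filter Finset
open scoped ENNReal NNReal Classical

/-- The finite set of vectors indexed by `ι` having exactly `w` nonzero entries,
each nonzero entry lying in the finite set `U`. -/
noncomputable def sparseVecs (U : Finset ℝ) (ι : Type) [Fintype ι] [DecidableEq ι]
    (w : ℕ) : Finset (ι → ℝ) :=
  (Fintype.piFinset fun _ : ι => insert (0 : ℝ) U).filter
    fun x => (Finset.univ.filter fun i => x i ≠ 0).card = w

/-- Uniform probability measure on a finite set. -/
noncomputable def uniformOn {α : Type*} [MeasurableSpace α] (S : Finset α) : Measure α :=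
  (S.card : ℝ≥0∞)⁻¹ • ∑ x ∈ S, Measure.dirac x

/-- Coordinatewise lower bound on the squared-error increment `(w - d)² - w²`, `d = z - x`, when
the nonzero values of `x` have modulus at least `m`. -/
theorem sq_error_coord_le {m τ η x z w : ℝ} (hη : 0 < η) (hη3 : 3 * η < 1)
    (hτ : τ ^ 2 ≤ (1 - 3 * η) * m ^ 2) (hx : x ≠ 0 → m ^ 2 ≤ x ^ 2) :
    η * (x - z) ^ 2 ≤ ((x + w - z) ^ 2 - w ^ 2) + (if x ≠ 0 then w ^ 2 / η else 0)
      + (if τ ^ 2 < w ^ 2 then w ^ 2 else 0) / (1 - η)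
      + τ ^ 2 / (1 - η) * ((if z ≠ 0 then 1 else 0) - (if x ≠ 0 then 1 else 0)) := by
  have h1 : 0 < 1 - η := by linarith
  have hind : w ^ 2 / (1 - η) ≤
      (if τ ^ 2 < w ^ 2 then w ^ 2 else 0) / (1 - η) + τ ^ 2 / (1 - η) := by
    rw [← add_div]
    gcongr
    split_ifs <;> nlinarith [sq_nonneg τ]
  have hind0 : 0 ≤ (if τ ^ 2 < w ^ 2 then w ^ 2 else 0) / (1 - η) := by
    apply div_nonneg _ h1.le
    split_ifs <;> positivity
  have young : ∀ c : ℝ, 0 < c → ∀ d : ℝ, 0 ≤ c * d ^ 2 + 2 * w * d + w ^ 2 / c := by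
    intro c hc d
    have : c * d ^ 2 + 2 * w * d + w ^ 2 / c = (c * d + w) ^ 2 / c := by field_simp; ring
    rw [this]; positivity
  have hττ : τ ^ 2 / (1 - η) ≤ (1 - 2 * η) * m ^ 2 := by
    rw [div_le_iff₀ h1]
    nlinarith [mul_nonneg (sq_nonneg η) (sq_nonneg m)]
  by_cases hx0 : x = 0 <;> by_cases hz0 : z = 0
  · subst hx0 hz0
    simpa using hind0
  · subst hx0
    simp only [ne_eq, not_true_eq_false, if_false, hz0, not_false_eq_true, if_true]
    have := young (1 - η) h1 (0 - z)
    linarith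
  · subst hz0
    simp only [ne_eq, not_true_eq_false, if_false, hx0, not_false_eq_true, if_true]
    have := young η hη (x - 0)
    have := mul_le_mul_of_nonneg_left (hx hx0) (by linarith : 0 ≤ 1 - 2 * η)
    linarith
  · simp only [ne_eq, hx0, hz0, not_false_eq_true, if_true]
    have := young η hη (x - z)
    have : 0 ≤ (1 - 2 * η) * (x - z) ^ 2 := mul_nonneg (by linarith) (sq_nonneg _)
    linarith

/-- If `z` fits the observation `x + w` at least as well as the true signal `x`, and both have the
same number of nonzero entries, then the squared error is controlled by the noise on the support
of `x` and by the large noise entries. -/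
theorem sum_sq_error_le {ι : Type*} [Fintype ι] {m τ η : ℝ} (hη : 0 < η) (hη3 : 3 * η < 1)
    (hτ : τ ^ 2 ≤ (1 - 3 * η) * m ^ 2) {x z w : ι → ℝ} (hx : ∀ i, x i ≠ 0 → m ^ 2 ≤ x i ^ 2)
    (hcard : (univ.filter fun i => x i ≠ 0).card = (univ.filter fun i => z i ≠ 0).card)
    (hfit : ∑ i, (x i + w i - z i) ^ 2 ≤ ∑ i, w i ^ 2) :
    ∑ i, (x i - z i) ^ 2 ≤ (∑ i ∈ univ.filter fun i => x i ≠ 0, w i ^ 2 / η ^ 2)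
      + ∑ i, (if τ ^ 2 < w i ^ 2 then w i ^ 2 else 0) / (η * (1 - η)) := by
  have hsum := Finset.sum_le_sum fun i (_ : i ∈ univ) =>
    sq_error_coord_le (z := z i) (w := w i) hη hη3 hτ (hx i)
  have hc : ∑ i, ((if z i ≠ 0 then (1 : ℝ) else 0) - (if x i ≠ 0 then 1 else 0)) = 0 := by
    rw [Finset.sum_sub_distrib, Finset.sum_boole, Finset.sum_boole, hcard, sub_self]
  simp only [Finset.sum_add_distrib, Finset.sum_sub_distrib, ← Finset.mul_sum] at hsum hc
  rw [hc, ← Finset.sum_filter] at hsum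
  have e1 : ∑ i ∈ univ.filter fun i => x i ≠ 0, w i ^ 2 / η ^ 2
      = (∑ i ∈ univ.filter fun i => x i ≠ 0, w i ^ 2 / η) / η := by
    rw [Finset.sum_div]
    exact Finset.sum_congr rfl fun i _ => by rw [div_div, sq η]
  have e2 : ∑ i, (if τ ^ 2 < w i ^ 2 then w i ^ 2 else 0) / (η * (1 - η))
      = (∑ i, (if τ ^ 2 < w i ^ 2 then w i ^ 2 else 0) / (1 - η)) / η := by
    rw [Finset.sum_div]
    exact Finset.sum_congr rfl fun i _ => by rw [div_div, mul_comm η]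
  rw [e1, e2, ← add_div, le_div_iff₀ hη]
  linarith

/-- Exponential domination of the truncated square. -/
theorem truncated_sq_le_exp {τ t w : ℝ} (hτ : 0 < τ) (ht : 1 ≤ t) :
    (if τ ^ 2 < w ^ 2 then w ^ 2 else 0) ≤
      (τ ^ 2 + 2 * τ + 2) * exp (-(t * τ)) * (exp (t * w) + exp (-t * w)) := by
  have key : ∀ a : ℝ, τ < a → a ^ 2 ≤ (τ ^ 2 + 2 * τ + 2) * exp (-(t * τ)) * exp (t * a) := by
    intro a ha
    have hs : 0 < a - τ := sub_pos.2 ha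
    have h1 := Real.quadratic_le_exp_of_nonneg hs.le
    have h2 : exp (a - τ) ≤ exp (-(t * τ)) * exp (t * a) := by
      rw [← Real.exp_add]
      apply Real.exp_le_exp.2
      nlinarith
    calc a ^ 2 = τ ^ 2 + 2 * τ * (a - τ) + (a - τ) ^ 2 := by ring
      _ ≤ (τ ^ 2 + 2 * τ + 2) * (1 + (a - τ) + (a - τ) ^ 2 / 2) := by
        have := mul_pos hτ hs
        have := mul_nonneg hτ.le (sq_nonneg (a - τ))
        have := mul_nonneg (sq_nonneg τ) (sq_nonneg (a - τ))
        have := mul_nonneg (sq_nonneg τ) hs.le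
        nlinarith
      _ ≤ (τ ^ 2 + 2 * τ + 2) * (exp (-(t * τ)) * exp (t * a)) := by gcongr; linarith
      _ = _ := by ring
  have hpos : ∀ b : ℝ, 0 ≤ (τ ^ 2 + 2 * τ + 2) * exp (-(t * τ)) * exp b := fun b => by positivity
  rw [mul_add]
  split_ifs with h
  · have hlt := sq_lt_sq.1 h
    rw [abs_of_pos hτ] at hlt
    rcases lt_abs.1 hlt with h' | h'
    · linarith [key w h', hpos (-t * w)]
    · have := key (-w) h'
      rw [neg_sq, show t * -w = -t * w by ring] at this
      linarith [hpos (t * w)]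
  · linarith [hpos (t * w), hpos (-t * w)]

theorem integrable_sq_gaussianReal (v : ℝ≥0) : Integrable (fun w => w ^ 2) (gaussianReal 0 v) :=
  (memLp_id_gaussianReal (μ := 0) (v := v) 2).integrable_sq

theorem integral_sq_gaussianReal (v : ℝ≥0) : ∫ w, w ^ 2 ∂(gaussianReal 0 v) = v := by
  have h := variance_eq_integral (μ := gaussianReal 0 v) (X := id) measurable_id.aemeasurable
  rw [variance_id_gaussianReal] at h
  simpa using h.symm

theorem integral_exp_mul_gaussianReal (v : ℝ≥0) (t : ℝ) :
    ∫ w, exp (t * w) ∂(gaussianReal 0 v) = exp (v * t ^ 2 / 2) := by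
  have h := congrFun (mgf_fun_id_gaussianReal (μ := 0) (v := v)) t
  simpa [mgf] using h

/-- Truncated second moment of a centred Gaussian. -/
theorem lintegral_truncated_sq_gaussianReal_le {τ : ℝ} (hτ : 0 < τ) {v : ℝ≥0} (hv : 0 < v)
    (hvτ : v ≤ τ) {c : ℝ} (hc : 0 < c) :
    ∫⁻ w, ENNReal.ofReal ((if τ ^ 2 < w ^ 2 then w ^ 2 else 0) / c) ∂(gaussianReal 0 v) ≤
      ENNReal.ofReal (2 * (τ ^ 2 + 2 * τ + 2) / c * exp (-(τ ^ 2 / (2 * v)))) := by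
  have hv' : (0 : ℝ) < v := hv
  set t : ℝ := τ / v with ht
  have ht1 : 1 ≤ t := (one_le_div hv').2 hvτ
  set f : ℝ → ℝ := fun w =>
    (τ ^ 2 + 2 * τ + 2) * exp (-(t * τ)) / c * (exp (t * w) + exp (-t * w)) with hf
  have hi : ∀ s : ℝ, Integrable (fun w => exp (s * w)) (gaussianReal 0 v) := fun s =>
    integrable_exp_mul_gaussianReal s
  calc _ ≤ ∫⁻ w, ENNReal.ofReal (f w) ∂(gaussianReal 0 v) := by
        apply lintegral_mono
        intro w
        apply ENNReal.ofReal_le_ofReal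
        simp only [hf]
        rw [div_mul_eq_mul_div]
        exact div_le_div_of_nonneg_right (truncated_sq_le_exp hτ ht1) hc.le
    _ = ENNReal.ofReal (∫ w, f w ∂(gaussianReal 0 v)) := by
        refine (ofReal_integral_eq_lintegral_ofReal (((hi t).add (hi (-t))).const_mul _) ?_).symm
        exact .of_forall fun w => by
          simp only [Pi.zero_apply, Pi.add_apply]
          positivity
    _ = _ := by
        congr 1
        simp only [hf]
        rw [integral_const_mul, integral_add (hi _) (hi _), integral_exp_mul_gaussianReal,
          integral_exp_mul_gaussianReal, neg_sq]
        have : exp (-(τ ^ 2 / (2 * v))) = exp (-(t * τ)) * exp (v * t ^ 2 / 2) := by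
          rw [← Real.exp_add]
          congr 1
          rw [ht]
          field_simp
          ring
        rw [this]
        ring

theorem lintegral_uniformOn_le {α : Type*} [MeasurableSpace α] [MeasurableSingletonClass α]
    (S : Finset α) (f : α → ℝ≥0∞) (B : ℝ≥0∞) (h : ∀ x ∈ S, f x ≤ B) :
    ∫⁻ x, f x ∂(uniformOn S) ≤ B := by
  rw [_root_.uniformOn, lintegral_smul_measure, lintegral_finsetSum_measure]
  simp only [lintegral_dirac, smul_eq_mul]
  calc _ ≤ (S.card : ℝ≥0∞)⁻¹ * (S.card * B) := by
        gcongr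
        simpa using Finset.sum_le_card_nsmul S f B h
    _ ≤ B := by
        rw [← mul_assoc]
        exact mul_le_of_le_one_left' (ENNReal.inv_mul_le_one _)

instance sFinite_uniformOn {α : Type*} [MeasurableSpace α] (S : Finset α) :
    SFinite (uniformOn S) := by
  unfold _root_.uniformOn
  infer_instance

/-- Nonasymptotic bound on the mean square error of the maximum likelihood estimator. -/
theorem lintegral_sq_error_le {U : Finset ℝ} {m τ η : ℝ} (hm : 0 < m) (hU : ∀ u ∈ U, m ≤ |u|)
    (hη : 0 < η) (hη3 : 3 * η < 1) (hτ0 : 0 < τ) (hτ : τ ^ 2 ≤ (1 - 3 * η) * m ^ 2)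
    {v : ℝ≥0} (hv : 0 < v) (hvτ : v ≤ τ) {ι : Type} [Fintype ι] [DecidableEq ι] {k : ℕ}
    {xhat : (ι → ℝ) → ι → ℝ}
    (hrange : ∀ y, xhat y ∈ sparseVecs U ι k)
    (hML : ∀ y : ι → ℝ, ∀ x' ∈ sparseVecs U ι k,
      ∑ i, (y i - xhat y i) ^ 2 ≤ ∑ i, (y i - x' i) ^ 2) :
    ∫⁻ p : (ι → ℝ) × (ι → ℝ), ENNReal.ofReal (∑ i, (p.1 i - xhat (p.1 + p.2) i) ^ 2)
        ∂((uniformOn (sparseVecs U ι k)).prod (Measure.pi fun _ : ι => gaussianReal 0 v)) ≤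
      k * ENNReal.ofReal (v / η ^ 2) + Fintype.card ι * ENNReal.ofReal
        (2 * (τ ^ 2 + 2 * τ + 2) / (η * (1 - η)) * exp (-(τ ^ 2 / (2 * v)))) := by
  have hη1 : 0 < η * (1 - η) := mul_pos hη (by linarith)
  have heval : ∀ (i : ι) {f : ℝ → ℝ≥0∞}, Measurable f →
      ∫⁻ w, f (w i) ∂(Measure.pi fun _ : ι => gaussianReal 0 v) =
        ∫⁻ w, f w ∂(gaussianReal 0 v) := fun i f hf =>
    (measurePreserving_eval (fun _ : ι => gaussianReal 0 v) i).lintegral_comp hf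
  have m1 : Measurable fun w : ℝ => ENNReal.ofReal (w ^ 2 / η ^ 2) := by fun_prop
  have m1' : ∀ i : ι, Measurable fun w : ι → ℝ => ENNReal.ofReal (w i ^ 2 / η ^ 2) :=
    fun i => m1.comp (measurable_pi_apply i)
  have m2 : Measurable fun w : ℝ =>
      ENNReal.ofReal ((if τ ^ 2 < w ^ 2 then w ^ 2 else 0) / (η * (1 - η))) := by
    refine ENNReal.measurable_ofReal.comp (Measurable.div_const ?_ _)
    exact Measurable.ite (measurableSet_lt (by fun_prop) (by fun_prop)) (by fun_prop) (by fun_prop)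
  have m2' : ∀ i : ι, Measurable fun w : ι → ℝ =>
      ENNReal.ofReal ((if τ ^ 2 < w i ^ 2 then w i ^ 2 else 0) / (η * (1 - η))) :=
    fun i => m2.comp (measurable_pi_apply i)
  refine (lintegral_prod_le _).trans (lintegral_uniformOn_le _ _ _ fun x hx => ?_)
  have mem : ∀ z ∈ sparseVecs U ι k, (∀ i, z i = 0 ∨ z i ∈ U) ∧
      (univ.filter fun i => z i ≠ 0).card = k := by
    intro z hz
    simpa [sparseVecs] using hz
  obtain ⟨hxU, hxk⟩ := mem x hx
  calc _ ≤ ∫⁻ w : ι → ℝ, ((∑ i ∈ univ.filter fun i => x i ≠ 0, ENNReal.ofReal (w i ^ 2 / η ^ 2))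
        + ∑ i, ENNReal.ofReal ((if τ ^ 2 < w i ^ 2 then w i ^ 2 else 0) / (η * (1 - η))))
          ∂(Measure.pi fun _ : ι => gaussianReal 0 v) := by
        apply lintegral_mono
        intro w
        have hn1 : ∀ i, 0 ≤ w i ^ 2 / η ^ 2 := fun i => by positivity
        have hn2 : ∀ i, 0 ≤ (if τ ^ 2 < w i ^ 2 then w i ^ 2 else 0) / (η * (1 - η)) := fun i =>
          div_nonneg (by split_ifs <;> positivity) hη1.le
        dsimp only
        rw [← ENNReal.ofReal_sum_of_nonneg fun i _ => hn1 i,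
          ← ENNReal.ofReal_sum_of_nonneg fun i _ => hn2 i,
          ← ENNReal.ofReal_add (sum_nonneg fun i _ => hn1 i) (sum_nonneg fun i _ => hn2 i)]
        apply ENNReal.ofReal_le_ofReal
        refine sum_sq_error_le hη hη3 hτ (fun i hi => ?_) ?_ ?_
        · have := hU _ ((hxU i).resolve_left hi)
          rw [← sq_abs (x i)]
          gcongr
        · rw [hxk, (mem _ (hrange _)).2]
        · simpa using hML (x + w) x hx
    _ = ∑ i ∈ univ.filter (fun i => x i ≠ 0),
          ∫⁻ w, ENNReal.ofReal (w ^ 2 / η ^ 2) ∂(gaussianReal 0 v)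
        + ∑ i : ι, ∫⁻ w, ENNReal.ofReal ((if τ ^ 2 < w ^ 2 then w ^ 2 else 0) / (η * (1 - η)))
          ∂(gaussianReal 0 v) := by
        rw [lintegral_add_left (Finset.measurable_fun_sum _ fun i _ => m1' i),
          lintegral_finsetSum _ fun i _ => m1' i, lintegral_finsetSum _ fun i _ => m2' i]
        congr 1
        · exact Finset.sum_congr rfl fun i _ => heval i m1
        · exact Finset.sum_congr rfl fun i _ => heval i m2
    _ ≤ _ := by
        rw [sum_const, sum_const, hxk, nsmul_eq_mul, nsmul_eq_mul, Finset.card_univ]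
        gcongr
        · rw [← ofReal_integral_eq_lintegral_ofReal
            ((integrable_sq_gaussianReal v).div_const _) (.of_forall fun w => by positivity),
            integral_div, integral_sq_gaussianReal]
        · exact lintegral_truncated_sq_gaussianReal_le hτ0 hv hvτ hη1

/-- In the sublinear sparsity limit, `log (N / k) → ∞`. -/
theorem tendsto_log_div_atTop {γ : ℝ} (hγ1 : γ < 1) {k N : ℕ → ℕ} (hk : Tendsto k atTop atTop)
    (hkN : ∀ n, k n < N n)
    (hγ : Tendsto (fun n => Real.log (k n) / Real.log (N n)) atTop (nhds γ)) :
    Tendsto (fun n => Real.log ((N n : ℝ) / (k n : ℝ))) atTop atTop := by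
  have hN : Tendsto (fun n => Real.log (N n)) atTop atTop :=
    Real.tendsto_log_atTop.comp (tendsto_natCast_atTop_atTop.comp
      (tendsto_atTop_mono (fun n => (hkN n).le) hk))
  refine (hN.atTop_mul_pos (sub_pos.2 hγ1) (hγ.const_sub 1)).congr' ?_
  filter_upwards [hk.eventually_ge_atTop 1, hN.eventually_gt_atTop 0] with n hn hn'
  have h1 : (k n : ℝ) ≠ 0 := by positivity
  have h2 : (N n : ℝ) ≠ 0 := by have := hkN n; norm_cast; omega
  rw [Real.log_div h2 h1]
  field_simp

theorem ml_achievability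
    (U : Finset ℝ) (hU : U.Nonempty) (hU0 : ∀ u ∈ U, u ≠ 0)
    (umin : ℝ) (humin : IsLeast {t : ℝ | ∃ u ∈ U, t = |u|} umin)
    (σ2 : ℝ) (hσpos : 0 < σ2) (hσ : σ2 < umin ^ 2 / 2)
    (γ : ℝ) (hγ0 : 0 ≤ γ) (hγ1 : γ < 1)
    (k N : ℕ → ℕ) (hk : Tendsto k atTop atTop) (hkN : ∀ n, k n < N n)
    (hγ : Tendsto (fun n => Real.log (k n) / Real.log (N n)) atTop (nhds γ))
    (xhat : (n : ℕ) → (Fin (N n) → ℝ) → (Fin (N n) → ℝ))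
    (hmeas : ∀ n, Measurable (xhat n))
    (hrange : ∀ n y, xhat n y ∈ sparseVecs U (Fin (N n)) (k n))
    (hML : ∀ n (y : Fin (N n) → ℝ), ∀ x' ∈ sparseVecs U (Fin (N n)) (k n),
      ∑ i, (y i - xhat n y i) ^ 2 ≤ ∑ i, (y i - x' i) ^ 2) :
    Tendsto (fun n =>
      (k n : ℝ≥0∞)⁻¹ *
        ∫⁻ p : (Fin (N n) → ℝ) × (Fin (N n) → ℝ),
          ENNReal.ofReal (∑ i, (p.1 i - xhat n (p.1 + p.2) i) ^ 2)
          ∂((uniformOn (sparseVecs U (Fin (N n)) (k n))).prod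
            (Measure.pi fun _ : Fin (N n) =>
              gaussianReal 0 (σ2 / Real.log ((N n : ℝ) / (k n : ℝ))).toNNReal)))
      atTop (nhds 0) := by
  have hm : 0 < umin := by
    obtain ⟨u, hu, rfl⟩ := humin.1
    exact abs_pos.2 (hU0 u hu)
  have hUm : ∀ u ∈ U, umin ≤ |u| := fun u hu => humin.2 ⟨u, hu, rfl⟩
  obtain ⟨T, hT1, hT2⟩ : ∃ T, 2 * σ2 < T ∧ T < umin ^ 2 := exists_between (by linarith)
  have hT0 : 0 < T := by linarith
  set τ := √T with hτdef
  have hτ0 : 0 < τ := Real.sqrt_pos.2 hT0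
  have hτ2 : τ ^ 2 = T := Real.sq_sqrt hT0.le
  have hm2 : 0 < umin ^ 2 := by positivity
  set η := (1 - T / umin ^ 2) / 3 with hηdef
  have hq1 : T / umin ^ 2 < 1 := (div_lt_one hm2).2 hT2
  have hq0 : 0 < T / umin ^ 2 := by positivity
  have hη : 0 < η := by rw [hηdef]; linarith
  have hη3 : 3 * η < 1 := by rw [hηdef]; linarith
  have hτη : τ ^ 2 ≤ (1 - 3 * η) * umin ^ 2 := by
    rw [hτ2, hηdef]
    apply le_of_eq
    field_simp
    ring
  set C := 2 * (τ ^ 2 + 2 * τ + 2) / (η * (1 - η)) with hC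
  have hC0 : 0 ≤ C := div_nonneg (by positivity) (mul_nonneg hη.le (by linarith))
  set L : ℕ → ℝ := fun n => Real.log ((N n : ℝ) / (k n : ℝ)) with hL
  have hLlim : Tendsto L atTop atTop := tendsto_log_div_atTop hγ1 hk hkN hγ
  set a := T / (2 * σ2) - 1 with ha
  have ha0 : 0 < a := by rw [ha, sub_pos, one_lt_div (by linarith)]; exact hT1
  have hvlim : Tendsto (fun n => σ2 / L n) atTop (nhds 0) := hLlim.const_div_atTop σ2
  have hreal : Tendsto (fun n => σ2 / L n / η ^ 2 + C * exp (-(a * L n))) atTop (nhds 0) := by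
    have h1 := hvlim.div_const (η ^ 2)
    have h2 := (Real.tendsto_exp_neg_atTop_nhds_zero.comp
      (hLlim.const_mul_atTop ha0)).const_mul C
    simpa using h1.add h2
  have hlim := ENNReal.tendsto_ofReal hreal
  rw [ENNReal.ofReal_zero] at hlim
  refine tendsto_of_tendsto_of_tendsto_of_le_of_le' tendsto_const_nhds hlim
    (.of_forall fun _ => zero_le) ?_
  filter_upwards [hk.eventually_ge_atTop 1, hLlim.eventually_gt_atTop 0,
    hvlim.eventually_lt_const hτ0] with n hkn hLn hvn
  have hv0 : 0 < σ2 / L n := by positivity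
  have hcoe : ((σ2 / L n).toNNReal : ℝ) = σ2 / L n := Real.coe_toNNReal _ hv0.le
  have hkr : (0 : ℝ) < k n := by exact_mod_cast hkn
  have hNr : (0 : ℝ) < N n := by exact_mod_cast (Nat.zero_le _).trans_lt (hkN n)
  have hk0 : (k n : ℝ≥0∞) ≠ 0 := by simp; omega
  have hbound := lintegral_sq_error_le hm hUm hη hη3 hτ0 hτη (Real.toNNReal_pos.2 hv0)
    (by rw [hcoe]; exact hvn.le) (hrange n) (hML n)
  rw [hcoe, Fintype.card_fin] at hbound
  refine (mul_le_mul_right hbound _).trans ?_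
  rw [mul_add, ← mul_assoc, ENNReal.inv_mul_cancel hk0 (ENNReal.natCast_ne_top _), one_mul,
    ENNReal.ofReal_add (by positivity) (by positivity)]
  refine add_le_add_right (le_of_eq ?_) _
  rw [← ENNReal.ofReal_natCast, ← ENNReal.ofReal_natCast, ← ENNReal.ofReal_inv_of_pos hkr,
    ← ENNReal.ofReal_mul hNr.le, ← ENNReal.ofReal_mul (by positivity)]
  congr 1
  have hexp : (N n : ℝ) / k n = exp (L n) := (Real.exp_log (by positivity)).symm
  have hsplit : exp (-(a * L n)) = exp (L n) * exp (-(τ ^ 2 / (2 * (σ2 / L n)))) := by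
    rw [← Real.exp_add, hτ2]
    congr 1
    rw [ha]
    field_simp
    ring
  rw [hsplit, ← hexp]
  ring
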